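/- arXiv:1903.09387 — 3 statements merged into one kernel-verified Lean document; each statement's English description precedes it below -/
import Mathlib

section
/- Let (X,κ_A) be a pair of (possibly dependent) nonnegative random variables with E[X²]<∞, E[κ_A²]<∞, and κ=E[κ_A]<1, and let D be a nonnegative random variable whose Laplace transform φ(s)=E[e^{−sD}] satisfies the functional equation φ(s)=E[e^{−sX}·e^{κ_A(φ(s)−1)}] for all s≥0. Then E[D]=E[X]/(1−κ) and E[D²] = E[X²]/(1−κ) + (E[X])²·E[κ_A²]/(1−κ)³ + 2·E[X]·E[Xκ_A]/(1−κ)² < ∞. -/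
open MeasureTheory ProbabilityTheory Filter Topology

lemma hk_exp_upper {x : ℝ} (hx : 0 ≤ x) : Real.exp (-x) - 1 + x ≤ x ^ 2 / 2 := by
  have h1 := Real.quadratic_le_exp_of_nonneg hx
  have h2 : Real.exp (-x) * Real.exp x = 1 := by rw [← Real.exp_add]; simp
  have h3 := Real.exp_pos (-x)
  have h4 : Real.exp (-x) * (1 + x + x ^ 2 / 2) ≤ 1 := by
    calc _ ≤ Real.exp (-x) * Real.exp x := mul_le_mul_of_nonneg_left h1 h3.le
      _ = 1 := h2
  have h5 : 0 < 1 + x + x ^ 2 / 2 := by positivity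
  have h6 : Real.exp (-x) * (1 + x + x ^ 2 / 2)
      ≤ (1 - x + x ^ 2 / 2) * (1 + x + x ^ 2 / 2) := by
    nlinarith [sq_nonneg (x ^ 2)]
  have := le_of_mul_le_mul_right h6 h5
  linarith

lemma hk_exp_lower (x : ℝ) : 0 ≤ Real.exp (-x) - 1 + x := by
  have := Real.add_one_le_exp (-x); linarith

lemma hk_tendsto2 {s y : ℕ → ℝ} {l : ℝ} (hs : ∀ n, 0 < s n) (hs0 : Tendsto s atTop (𝓝 0))
    (hy : Tendsto y atTop (𝓝 l)) :
    Tendsto (fun n => (Real.exp (-(s n * y n)) - 1 + s n * y n) / s n ^ 2) atTop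
      (𝓝 (l ^ 2 / 2)) := by
  have hsy : Tendsto (fun n => s n * y n) atTop (𝓝 0) := by simpa using hs0.mul hy
  have hb : Tendsto (fun n => s n * |y n| ^ 3) atTop (𝓝 0) := by
    simpa using hs0.mul ((hy.abs).pow 3)
  have hd : Tendsto (fun n => (Real.exp (-(s n * y n)) - 1 + s n * y n) / s n ^ 2 - y n ^ 2 / 2)
      atTop (𝓝 0) := by
    refine squeeze_zero_norm' ?_ hb
    have he : ∀ᶠ n in atTop, |s n * y n| < 1 := by
      have := hsy.abs
      rw [abs_zero] at this
      exact this.eventually (gt_mem_nhds one_pos)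
    filter_upwards [he] with n hn
    have h := Real.exp_bound (x := -(s n * y n)) (by rw [abs_neg]; exact hn.le) (n := 3) (by norm_num)
    have hp := hs n
    have h' : |Real.exp (-(s n * y n)) - 1 + s n * y n - (s n * y n) ^ 2 / 2|
        ≤ (s n * |y n|) ^ 3 := by
      have e : Real.exp (-(s n * y n)) - 1 + s n * y n - (s n * y n) ^ 2 / 2
        = Real.exp (-(s n * y n)) - ∑ m ∈ Finset.range 3, (-(s n * y n)) ^ m / (m.factorial : ℝ) := by
        simp [Finset.sum_range_succ]; ring
      rw [e]
      refine h.trans ?_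
      rw [abs_neg, abs_mul, abs_of_pos hp]
      have : 0 ≤ (s n * |y n|) ^ 3 := by positivity
      norm_num [Nat.factorial]
      nlinarith
    rw [Real.norm_eq_abs]
    have e2 : (Real.exp (-(s n * y n)) - 1 + s n * y n) / s n ^ 2 - y n ^ 2 / 2
       = (Real.exp (-(s n * y n)) - 1 + s n * y n - (s n * y n) ^ 2 / 2) / s n ^ 2 := by
      field_simp
    rw [e2, abs_div, abs_of_pos (by positivity : 0 < s n ^ 2), div_le_iff₀ (by positivity)]
    refine h'.trans (le_of_eq ?_)
    ring
  have := hd.add ((hy.pow 2).div_const 2)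
  simpa using this

lemma hk_tendsto1 {s y : ℕ → ℝ} {l : ℝ} (hs : ∀ n, 0 < s n) (hs0 : Tendsto s atTop (𝓝 0))
    (hy : Tendsto y atTop (𝓝 l)) :
    Tendsto (fun n => (1 - Real.exp (-(s n * y n))) / s n) atTop (𝓝 l) := by
  have h := hy.sub (hs0.mul (hk_tendsto2 hs hs0 hy))
  simp only [zero_mul, sub_zero] at h
  refine h.congr fun n => ?_
  have := hs n
  field_simp
  ring

lemma hk_fatou {Ω : Type*} [MeasurableSpace Ω] {P : Measure Ω} {f : ℕ → Ω → ℝ} {F : Ω → ℝ} {C : ℝ}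
    (hF : Measurable F) (hfi : ∀ n, Integrable (f n) P) (hfm : ∀ n, Measurable (f n))
    (hf0 : ∀ n ω, 0 ≤ f n ω)
    (hlim : ∀ ω, Tendsto (fun n => f n ω) atTop (𝓝 (F ω))) (hC : ∀ n, ∫ ω, f n ω ∂P ≤ C) :
    Integrable F P := by
  refine ⟨hF.aestronglyMeasurable, ?_⟩
  have hF0 : ∀ ω, 0 ≤ F ω := fun ω => ge_of_tendsto' (hlim ω) (fun n => hf0 n ω)
  rw [hasFiniteIntegral_iff_ofReal (Eventually.of_forall hF0)]
  have h1 : ∀ ω, ENNReal.ofReal (F ω) = liminf (fun n => ENNReal.ofReal (f n ω)) atTop := fun ω =>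
    ((ENNReal.continuous_ofReal.tendsto _).comp (hlim ω)).liminf_eq.symm
  simp_rw [h1]
  refine (lintegral_liminf_le (fun n => (hfm n).ennreal_ofReal)).trans_lt ?_
  refine lt_of_le_of_lt (b := ENNReal.ofReal C) ?_ ENNReal.ofReal_lt_top
  refine liminf_le_of_le (by isBoundedDefault) ?_
  intro b hb
  obtain ⟨n, hn⟩ := hb.exists
  refine hn.trans ?_
  rw [← ofReal_integral_eq_lintegral_ofReal (hfi n) (Eventually.of_forall (hf0 n))]
  exact ENNReal.ofReal_le_ofReal (hC n)

lemma hk_expint {Ω : Type*} [MeasurableSpace Ω] {P : Measure Ω} [IsProbabilityMeasure P]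
    {Y : Ω → ℝ} (hY : Measurable Y) (hY0 : ∀ ω, 0 ≤ Y ω) {s : ℝ} (hs : 0 < s) :
    Integrable (fun ω => Real.exp (-(s * Y ω))) P := by
  refine Integrable.of_bound (by fun_prop) 1 (Eventually.of_forall fun ω => ?_)
  rw [Real.norm_eq_abs, abs_of_pos (Real.exp_pos _), Real.exp_le_one_iff]
  have := mul_nonneg hs.le (hY0 ω)
  linarith

/-- **First two moments of the Hawkes cluster sum.**
If the Laplace transform `φ(s) = E[e^{-sD}]` of a nonnegative random variable `D` satisfies
the Hawkes fixed-point equation `φ(s) = E[e^{-sX} e^{κ_A (φ(s)-1)}]` with `κ = E[κ_A] < 1`,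
`E[X²] < ∞` and `E[κ_A²] < ∞`, then `E[D] = E[X]/(1-κ)` and
`E[D²] = E[X²]/(1-κ) + (E[X])² E[κ_A²]/(1-κ)³ + 2 E[X] E[X κ_A]/(1-κ)² < ∞`. -/
theorem hawkes_cluster_moments
    {Ω : Type*} [MeasurableSpace Ω] (P : Measure Ω) [IsProbabilityMeasure P]
    (X κA D : Ω → ℝ)
    (hXmeas : Measurable X) (hκAmeas : Measurable κA) (hDmeas : Measurable D)
    (hXnn : ∀ ω, 0 ≤ X ω) (hκAnn : ∀ ω, 0 ≤ κA ω) (hDnn : ∀ ω, 0 ≤ D ω)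
    (hX2 : Integrable (fun ω => X ω ^ 2) P)
    (hκA2 : Integrable (fun ω => κA ω ^ 2) P)
    (hκA1 : Integrable κA P)
    (κ : ℝ) (hκ : κ = ∫ ω, κA ω ∂P) (hκlt : κ < 1)
    -- the fixed-point equation for the Laplace transform of `D`
    (hfix : ∀ s : ℝ, 0 ≤ s →
      ∫ ω, Real.exp (-(s * D ω)) ∂P
        = ∫ ω, Real.exp (-(s * X ω))
            * Real.exp (κA ω * ((∫ ω', Real.exp (-(s * D ω')) ∂P) - 1)) ∂P) :
    Integrable D P ∧
    ∫ ω, D ω ∂P = (∫ ω, X ω ∂P) / (1 - κ) ∧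
    Integrable (fun ω => D ω ^ 2) P ∧
    ∫ ω, D ω ^ 2 ∂P
      = (∫ ω, X ω ^ 2 ∂P) / (1 - κ)
        + (∫ ω, X ω ∂P) ^ 2 * (∫ ω, κA ω ^ 2 ∂P) / (1 - κ) ^ 3
        + 2 * (∫ ω, X ω ∂P) * (∫ ω, X ω * κA ω ∂P) / (1 - κ) ^ 2 := by
  have hX1 : Integrable X P :=
    ((memLp_two_iff_integrable_sq hXmeas.aestronglyMeasurable).2 hX2).integrable (by norm_num)
  have hXL := (memLp_two_iff_integrable_sq hXmeas.aestronglyMeasurable).2 hX2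
  have hκL := (memLp_two_iff_integrable_sq hκAmeas.aestronglyMeasurable).2 hκA2
  have hXκ : Integrable (fun ω => X ω * κA ω) P := hXL.integrable_mul hκL
  have hpos : 0 < 1 - κ := by linarith
  obtain ⟨s, hs, hs0⟩ : ∃ s : ℕ → ℝ, (∀ n, 0 < s n) ∧ Tendsto s atTop (𝓝 0) :=
    ⟨fun n => 1 / ((n : ℝ) + 1), fun n => by positivity, tendsto_one_div_add_atTop_nhds_zero_nat⟩
  obtain ⟨r, hr⟩ : ∃ r : ℕ → ℝ, ∀ n, r n = (1 - ∫ ω, Real.exp (-(s n * D ω)) ∂P) / s n :=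
    ⟨_, fun n => rfl⟩
  have hφ : ∀ n, ∫ ω, Real.exp (-(s n * D ω)) ∂P = 1 - s n * r n := fun n => by
    rw [hr, mul_div_cancel₀ _ (hs n).ne']; ring
  have hDe : ∀ n, Integrable (fun ω => Real.exp (-(s n * D ω))) P :=
    fun n => hk_expint hDmeas hDnn (hs n)
  have hr0 : ∀ n, 0 ≤ r n := fun n => by
    rw [hr]
    refine div_nonneg ?_ (hs n).le
    have : ∫ ω, Real.exp (-(s n * D ω)) ∂P ≤ ∫ ω, (1 : ℝ) ∂P := by
      refine integral_mono (hDe n) (integrable_const _) fun ω => ?_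
      have := mul_nonneg (hs n).le (hDnn ω)
      simpa using this
    simp at this
    linarith
  have hYnn : ∀ t : ℝ, 0 ≤ t → ∀ ω, 0 ≤ X ω + κA ω * t := fun t ht ω =>
    add_nonneg (hXnn ω) (mul_nonneg (hκAnn ω) ht)
  have hYm : ∀ t : ℝ, Measurable (fun ω => X ω + κA ω * t) := fun t => by fun_prop
  have hYi : ∀ t : ℝ, Integrable (fun ω => X ω + κA ω * t) P := fun t =>
    hX1.add (hκA1.mul_const t)
  have hYI : ∀ t : ℝ, ∫ ω, (X ω + κA ω * t) ∂P = (∫ ω, X ω ∂P) + κ * t := fun t => by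
    rw [integral_add hX1 (hκA1.mul_const t), integral_mul_const, hκ]
  have hYe : ∀ n, Integrable (fun ω => Real.exp (-(s n * (X ω + κA ω * r n)))) P :=
    fun n => hk_expint (hYm _) (hYnn _ (hr0 n)) (hs n)
  have hφY : ∀ n, ∫ ω, Real.exp (-(s n * (X ω + κA ω * r n))) ∂P = 1 - s n * r n := fun n => by
    have := hfix (s n) (hs n).le
    rw [hφ] at this
    rw [this]
    congr 1; ext ω
    rw [← Real.exp_add]
    congr 1; ring
  have hrD : ∀ n, ∫ ω, (1 - Real.exp (-(s n * D ω))) / s n ∂P = r n := fun n => by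
    rw [integral_div, integral_sub (integrable_const _) (hDe n), hφ]
    have := hs n
    simp
    field_simp
  have hrY : ∀ n, ∫ ω, (1 - Real.exp (-(s n * (X ω + κA ω * r n)))) / s n ∂P = r n := fun n => by
    rw [integral_div, integral_sub (integrable_const _) (hYe n), hφY]
    have := hs n
    simp
    field_simp
  have hle1 : ∀ n (y : ℝ), (1 - Real.exp (-(s n * y))) / s n ≤ y := fun n y => by
    rw [div_le_iff₀ (hs n)]
    have := hk_exp_lower (s n * y)
    linarith
  have hge1 : ∀ n (y : ℝ), 0 ≤ y → 0 ≤ (1 - Real.exp (-(s n * y))) / s n := fun n y hy => by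
    refine div_nonneg ?_ (hs n).le
    have := mul_nonneg (hs n).le hy
    have : Real.exp (-(s n * y)) ≤ 1 := by simpa using this
    linarith
  obtain ⟨m, hm⟩ : ∃ m, m = (∫ ω, X ω ∂P) / (1 - κ) := ⟨_, rfl⟩
  have hrm : ∀ n, r n ≤ m := fun n => by
    have h : r n ≤ (∫ ω, X ω ∂P) + κ * r n := by
      rw [← hYI]
      conv_lhs => rw [← hrY n]
      exact integral_mono (((integrable_const _).sub (hYe n)).div_const _) (hYi _)
        fun ω => hle1 n _
    rw [hm, le_div_iff₀ hpos]
    linarith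
  have hDi : Integrable D P :=
    hk_fatou (f := fun n ω => (1 - Real.exp (-(s n * D ω))) / s n) (C := m) hDmeas
      (fun n => ((integrable_const _).sub (hDe n)).div_const _) (fun n => by fun_prop)
      (fun n ω => hge1 n _ (hDnn ω)) (fun ω => hk_tendsto1 hs hs0 tendsto_const_nhds)
      (fun n => (hrD n).trans_le (hrm n))
  have hrlim : Tendsto r atTop (𝓝 (∫ ω, D ω ∂P)) := by
    have := tendsto_integral_of_dominated_convergence
      (F := fun n ω => (1 - Real.exp (-(s n * D ω))) / s n) (f := D) (μ := P) D
      (fun n => by fun_prop) hDi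
      (fun n => Eventually.of_forall fun ω => by
        rw [Real.norm_eq_abs, abs_of_nonneg (hge1 n _ (hDnn ω))]; exact hle1 n _)
      (Eventually.of_forall fun ω => hk_tendsto1 hs hs0 tendsto_const_nhds)
    simpa only [hrD] using this
  obtain ⟨d, hd⟩ : ∃ d, d = ∫ ω, D ω ∂P := ⟨_, rfl⟩
  rw [← hd] at hrlim
  have hYlim : ∀ ω, Tendsto (fun n => X ω + κA ω * r n) atTop (𝓝 (X ω + κA ω * d)) := fun ω =>
    tendsto_const_nhds.add (tendsto_const_nhds.mul hrlim)
  have hYle : ∀ n ω, X ω + κA ω * r n ≤ X ω + κA ω * m := fun n ω => by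
    have := mul_le_mul_of_nonneg_left (hrm n) (hκAnn ω)
    linarith
  have hrlim2 : Tendsto r atTop (𝓝 (∫ ω, (X ω + κA ω * d) ∂P)) := by
    have := tendsto_integral_of_dominated_convergence
      (F := fun n ω => (1 - Real.exp (-(s n * (X ω + κA ω * r n)))) / s n)
      (f := fun ω => X ω + κA ω * d) (μ := P) (fun ω => X ω + κA ω * m)
      (fun n => by fun_prop) (hYi m)
      (fun n => Eventually.of_forall fun ω => by
        rw [Real.norm_eq_abs, abs_of_nonneg (hge1 n _ (hYnn _ (hr0 n) ω))]
        exact (hle1 n _).trans (hYle n ω))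
      (Eventually.of_forall fun ω => hk_tendsto1 hs hs0 (hYlim ω))
    simpa only [hrY] using this
  have hdeq : d = (∫ ω, X ω ∂P) + κ * d := by
    rw [← hYI]; exact tendsto_nhds_unique hrlim hrlim2
  have hdm : d = (∫ ω, X ω ∂P) / (1 - κ) := by
    rw [eq_div_iff hpos.ne']; linarith
  -- second moment
  have hge2 : ∀ n (y : ℝ), 0 ≤ (Real.exp (-(s n * y)) - 1 + s n * y) / s n ^ 2 := fun n y =>
    div_nonneg (hk_exp_lower _) (sq_nonneg _)
  have hle2 : ∀ n (y : ℝ), 0 ≤ y → (Real.exp (-(s n * y)) - 1 + s n * y) / s n ^ 2 ≤ y ^ 2 / 2 :=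
    fun n y hy => by
      rw [div_le_iff₀ (pow_pos (hs n) 2)]
      have := hk_exp_upper (mul_nonneg (hs n).le hy)
      linarith [mul_pow (s n) y 2]
  have hYsq : ∀ t : ℝ, ∀ ω, (X ω + κA ω * t) ^ 2 / 2
      = (X ω ^ 2 + (2 * t) * (X ω * κA ω) + t ^ 2 * κA ω ^ 2) / 2 := fun t ω => by ring
  have hY2i : ∀ t : ℝ, Integrable (fun ω => (X ω + κA ω * t) ^ 2 / 2) P := fun t => by
    simp_rw [hYsq]
    exact ((hX2.add (hXκ.const_mul _)).add (hκA2.const_mul _)).div_const _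
  have hY2I : ∀ t : ℝ, ∫ ω, (X ω + κA ω * t) ^ 2 / 2 ∂P
      = ((∫ ω, X ω ^ 2 ∂P) + (2 * t) * (∫ ω, X ω * κA ω ∂P) + t ^ 2 * ∫ ω, κA ω ^ 2 ∂P) / 2 :=
    fun t => by
      simp_rw [hYsq]
      rw [integral_div, integral_add (f := fun ω => X ω ^ 2 + (2 * t) * (X ω * κA ω))
          (hX2.add (hXκ.const_mul _)) (hκA2.const_mul _),
        integral_add hX2 (hXκ.const_mul _), integral_const_mul, integral_const_mul]
  have hDgi : ∀ n, Integrable (fun ω => (Real.exp (-(s n * D ω)) - 1 + s n * D ω) / s n ^ 2) P :=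
    fun n => (((hDe n).sub (integrable_const _)).add (hDi.const_mul _)).div_const _
  have hYgi : ∀ n, Integrable (fun ω => (Real.exp (-(s n * (X ω + κA ω * r n))) - 1
      + s n * (X ω + κA ω * r n)) / s n ^ 2) P :=
    fun n => (((hYe n).sub (integrable_const _)).add ((hYi _).const_mul _)).div_const _
  have hDg : ∀ n, ∫ ω, (Real.exp (-(s n * D ω)) - 1 + s n * D ω) / s n ^ 2 ∂P
      = (d - r n) / s n := fun n => by
    rw [integral_div, integral_add (f := fun ω => Real.exp (-(s n * D ω)) - 1)
      ((hDe n).sub (integrable_const _)) (hDi.const_mul _),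
      integral_sub (hDe n) (integrable_const _), integral_const_mul, hφ, ← hd]
    have := hs n
    simp
    field_simp
    ring
  have hYg : ∀ n, ∫ ω, (Real.exp (-(s n * (X ω + κA ω * r n))) - 1
      + s n * (X ω + κA ω * r n)) / s n ^ 2 ∂P = (1 - κ) * ((d - r n) / s n) := fun n => by
    rw [integral_div, integral_add (f := fun ω => Real.exp (-(s n * (X ω + κA ω * r n))) - 1)
      ((hYe n).sub (integrable_const _)) ((hYi _).const_mul _),
      integral_sub (hYe n) (integrable_const _), integral_const_mul, hφY, hYI]
    have := hs n
    have hx : ∫ ω, X ω ∂P = (1 - κ) * d := by linarith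
    rw [hx]
    simp
    field_simp
    ring
  have hbound : ∀ n, (d - r n) / s n ≤ (∫ ω, (X ω + κA ω * m) ^ 2 / 2 ∂P) / (1 - κ) := fun n => by
    rw [le_div_iff₀ hpos, mul_comm, ← hYg]
    refine integral_mono (hYgi n) (hY2i m) fun ω => ?_
    refine (hle2 n _ (hYnn _ (hr0 n) ω)).trans ?_
    have := hYle n ω
    have := hYnn _ (hr0 n) ω
    show (X ω + κA ω * r n) ^ 2 / 2 ≤ (X ω + κA ω * m) ^ 2 / 2
    gcongr
  have hD2' : Integrable (fun ω => D ω ^ 2 / 2) P :=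
    hk_fatou (f := fun n ω => (Real.exp (-(s n * D ω)) - 1 + s n * D ω) / s n ^ 2)
      (by fun_prop) hDgi (fun n => by fun_prop)
      (fun n ω => hge2 n _) (fun ω => hk_tendsto2 hs hs0 tendsto_const_nhds)
      (fun n => (hDg n).trans_le (hbound n))
  have hD2 : Integrable (fun ω => D ω ^ 2) P := by
    refine (hD2'.mul_const 2).congr (Eventually.of_forall fun ω => ?_)
    show D ω ^ 2 / 2 * 2 = D ω ^ 2
    ring
  have hl1 : Tendsto (fun n => (d - r n) / s n) atTop (𝓝 (∫ ω, D ω ^ 2 / 2 ∂P)) := by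
    have := tendsto_integral_of_dominated_convergence
      (F := fun n ω => (Real.exp (-(s n * D ω)) - 1 + s n * D ω) / s n ^ 2)
      (f := fun ω => D ω ^ 2 / 2) (μ := P) (fun ω => D ω ^ 2 / 2)
      (fun n => by fun_prop) hD2'
      (fun n => Eventually.of_forall fun ω => by
        rw [Real.norm_eq_abs, abs_of_nonneg (hge2 n _)]; exact hle2 n _ (hDnn ω))
      (Eventually.of_forall fun ω => hk_tendsto2 hs hs0 tendsto_const_nhds)
    simpa only [hDg] using this
  have hl2 : Tendsto (fun n => (1 - κ) * ((d - r n) / s n)) atTop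
      (𝓝 (∫ ω, (X ω + κA ω * d) ^ 2 / 2 ∂P)) := by
    have := tendsto_integral_of_dominated_convergence
      (F := fun n ω => (Real.exp (-(s n * (X ω + κA ω * r n))) - 1
        + s n * (X ω + κA ω * r n)) / s n ^ 2)
      (f := fun ω => (X ω + κA ω * d) ^ 2 / 2) (μ := P) (fun ω => (X ω + κA ω * m) ^ 2 / 2)
      (fun n => by fun_prop) (hY2i m)
      (fun n => Eventually.of_forall fun ω => by
        rw [Real.norm_eq_abs, abs_of_nonneg (hge2 n _)]
        refine (hle2 n _ (hYnn _ (hr0 n) ω)).trans ?_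
        have := hYnn _ (hr0 n) ω
        have := hYle n ω
        gcongr)
      (Eventually.of_forall fun ω => hk_tendsto2 hs hs0 (hYlim ω))
    simpa only [hYg] using this
  have hfin := tendsto_nhds_unique (hl1.const_mul (1 - κ)) hl2
  rw [hY2I, integral_div] at hfin
  refine ⟨hDi, hd ▸ hdm, hD2, ?_⟩
  have hE : ∫ ω, D ω ^ 2 ∂P = ((∫ ω, X ω ^ 2 ∂P) + (2 * d) * (∫ ω, X ω * κA ω ∂P)
      + d ^ 2 * ∫ ω, κA ω ^ 2 ∂P) / (1 - κ) := by
    rw [eq_div_iff hpos.ne']; linarith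
  rw [hE, hdm]
  field_simp
  ring
end

section
/- Let (X,κ_A) be a pair of (possibly dependent) nonnegative random variables with κ=E[κ_A]<1, and let D be a nonnegative random variable whose Laplace transform φ(s)=E[e^{−sD}] satisfies φ(s)=E[e^{−sX}·e^{κ_A(φ(s)−1)}] for all s≥0. If X is regularly varying with index α∈(0,1), then D is regularly varying with the same index α; more precisely, P(D>x) ~ P(X>x)/(1−κ) as x→∞. -/
open MeasureTheory ProbabilityTheory Filter

/-- A function `ℓ` is slowly varying (at infinity) if `ℓ(c x)/ℓ(x) → 1` for every `c > 0`. -/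
def SlowlyVarying (ℓ : ℝ → ℝ) : Prop :=
  ∀ c : ℝ, 0 < c → Tendsto (fun x => ℓ (c * x) / ℓ x) atTop (nhds 1)

/-- A random variable `Z` is regularly varying with index `α` if
`P(Z > x) = x^(-α) ℓ(x)` for some slowly varying `ℓ`. -/
def RegularlyVarying {Ω : Type*} [MeasurableSpace Ω] (P : Measure Ω)
    (Z : Ω → ℝ) (α : ℝ) : Prop :=
  ∃ ℓ : ℝ → ℝ, SlowlyVarying ℓ ∧
    ∀ x : ℝ, 0 < x → (P {ω | x < Z ω}).toReal = x ^ (-α) * ℓ x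


section HawkesAux

open Topology

variable {Ω : Type*} [MeasurableSpace Ω] {P : Measure Ω} [IsProbabilityMeasure P]

lemma hk_intg {f : Ω → ℝ} (C : ℝ) (hf : Measurable f) (h : ∀ ω, |f ω| ≤ C) : Integrable f P :=
  Integrable.of_bound hf.aestronglyMeasurable C (ae_of_all _ h)

lemma hk_tail_anti (Z : Ω → ℝ) {x y : ℝ} (h : x ≤ y) :
    (P {ω | y < Z ω}).toReal ≤ (P {ω | x < Z ω}).toReal := by
  apply ENNReal.toReal_mono (measure_ne_top _ _)
  apply measure_mono
  intro ω (hω : y < Z ω)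
  exact lt_of_le_of_lt h hω

lemma hk_tail_le_one (Z : Ω → ℝ) (x : ℝ) : (P {ω | x < Z ω}).toReal ≤ 1 := by
  have := ENNReal.toReal_mono ENNReal.one_ne_top (prob_le_one (μ := P) (s := {ω | x < Z ω}))
  simpa using this

lemma hk_tail_eq (Z : Ω → ℝ) (hZ : Measurable Z) (x : ℝ) :
    (P {ω | x < Z ω}).toReal = ∫ ω, Set.indicator {ω | x < Z ω} (fun _ => (1:ℝ)) ω ∂P := by
  rw [integral_indicator_const _ (measurableSet_lt measurable_const hZ)]
  simp [Measure.real]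

lemma hk_tail_pos (X : Ω → ℝ) {α : ℝ} (h : RegularlyVarying P X α) (x : ℝ) :
    0 < (P {ω | x < X ω}).toReal := by
  obtain ⟨l, hl, hF⟩ := h
  have h1 := hl 1 one_pos
  have h2 : ∀ᶠ y in atTop, l (1 * y) / l y ≠ 0 := h1.eventually_ne one_ne_zero
  obtain ⟨y, hy, hy0, hyx⟩ := (h2.and ((eventually_gt_atTop 0).and (eventually_ge_atTop x))).exists
  refine lt_of_lt_of_le ?_ (hk_tail_anti X hyx)
  refine lt_of_le_of_ne ENNReal.toReal_nonneg ?_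
  rw [hF y hy0]
  intro h0
  rcases mul_eq_zero.1 h0.symm with h3 | h3
  · exact (Real.rpow_pos_of_pos hy0 _).ne' h3
  · exact hy (by simp [h3])

lemma hk_tail_ratio (X : Ω → ℝ) {α : ℝ} (h : RegularlyVarying P X α) (c : ℝ) (hc : 0 < c) :
    Tendsto (fun x : ℝ => (P {ω | c * x < X ω}).toReal / (P {ω | x < X ω}).toReal) atTop
      (𝓝 (c ^ (-α))) := by
  obtain ⟨l, hl, hF⟩ := h
  have h1 := (hl c hc).const_mul (c ^ (-α))
  rw [mul_one] at h1
  refine h1.congr' ?_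
  filter_upwards [eventually_gt_atTop 0] with x hx
  rw [hF x hx, hF (c * x) (by positivity), Real.mul_rpow hc.le hx.le]
  have := (Real.rpow_pos_of_pos hx (-α)).ne'
  field_simp

/-- `E[min(X, x)] ≤ C x P(X > x)` for large `x`, in dyadic form. -/
lemma hk_bound (X : Ω → ℝ) (hX : Measurable X) (hXnn : ∀ ω, 0 ≤ X ω) {α : ℝ} (hα1 : α < 1)
    (h : RegularlyVarying P X α) :
    ∃ C x0 : ℝ, 0 < C ∧ 0 < x0 ∧ ∀ x, x0 ≤ x →
      ∫ ω, min (X ω) x ∂P ≤ C * x * (P {ω | x < X ω}).toReal := by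
  set F : ℝ → ℝ := fun x => (P {ω | x < X ω}).toReal with hFdef
  have hFpos : ∀ x, 0 < F x := hk_tail_pos X h
  have hr := hk_tail_ratio X h 2 two_pos
  obtain ⟨r, hr1, hr2⟩ : ∃ r : ℝ, (2:ℝ) ^ (α - 1) < r ∧ r < 1 := by
    apply exists_between
    exact Real.rpow_lt_one_of_one_lt_of_neg (by norm_num) (by linarith)
  have hr0 : 0 < r := lt_trans (Real.rpow_pos_of_pos two_pos _) hr1
  have hlt : (2 * r)⁻¹ < (2:ℝ) ^ (-α) := by
    rw [Real.rpow_neg two_pos.le]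
    apply inv_strictAnti₀ (Real.rpow_pos_of_pos two_pos _)
    rw [Real.rpow_sub two_pos, Real.rpow_one] at hr1
    linarith
  have hev := (hr.eventually_const_lt hlt).and (eventually_gt_atTop 0)
  obtain ⟨x0, hx0⟩ := eventually_atTop.1 hev
  have hx0pos : 0 < x0 := (hx0 x0 le_rfl).2
  have hstep : ∀ x, x0 ≤ x → F x ≤ 2 * r * F (2 * x) := by
    intro x hx
    have := (hx0 x hx).1
    rw [lt_div_iff₀ (hFpos x), inv_mul_lt_iff₀ (by positivity)] at this
    exact this.le
  have hm : ∀ x, 0 ≤ x → Integrable (fun ω => min (X ω) x) P := by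
    intro x hx
    refine hk_intg x (hX.min measurable_const) ?_
    intro ω
    rw [abs_of_nonneg (le_min (hXnn ω) hx)]
    exact min_le_right _ _
  have hdouble : ∀ x, 0 < x → ∫ ω, min (X ω) (2 * x) ∂P ≤ (∫ ω, min (X ω) x ∂P) + x * F x := by
    intro x hx
    have hi : Integrable (Set.indicator {ω | x < X ω} (fun _ => (1:ℝ))) P :=
      (integrable_const 1).indicator (measurableSet_lt measurable_const hX)
    have e : x * F x = ∫ ω, x * Set.indicator {ω | x < X ω} (fun _ => (1:ℝ)) ω ∂P := by
      rw [integral_const_mul, ← hk_tail_eq X hX]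
    rw [e, ← integral_add (hm x hx.le) (hi.const_mul x)]
    refine integral_mono (hm _ (by positivity)) ((hm x hx.le).add (hi.const_mul x)) ?_
    intro ω
    by_cases hω : x < X ω
    · have : ω ∈ {ω | x < X ω} := hω
      simp only [Set.indicator_of_mem this, mul_one]
      rw [min_eq_right hω.le]
      linarith [min_le_right (X ω) (2 * x)]
    · have : ω ∉ {ω | x < X ω} := hω
      simp only [Set.indicator_of_notMem this, mul_zero, add_zero]
      rw [min_eq_left (not_lt.1 hω)]
      exact min_le_left _ _
  set C := max (r / (1 - r)) (1 / F (2 * x0)) with hC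
  have hCpos : 0 < C := lt_of_lt_of_le (one_div_pos.2 (hFpos _)) (le_max_right _ _)
  have hC1 : (C + 1) * r ≤ C := by
    have : r / (1 - r) ≤ C := le_max_left _ _
    rw [div_le_iff₀ (by linarith)] at this
    linarith
  have hC2 : 1 ≤ C * F (2 * x0) := by
    have : 1 / F (2 * x0) ≤ C := le_max_right _ _
    rwa [div_le_iff₀ (hFpos _)] at this
  have key : ∀ n : ℕ, ∀ x, x0 ≤ x → x ≤ 2 ^ n * (2 * x0) →
      ∫ ω, min (X ω) x ∂P ≤ C * x * F x := by
    have base : ∀ x, x0 ≤ x → x ≤ 2 * x0 → ∫ ω, min (X ω) x ∂P ≤ C * x * F x := by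
      intro x hx hx'
      have hxp : 0 < x := by linarith
      have h1 : ∫ ω, min (X ω) x ∂P ≤ x := by
        calc _ ≤ ∫ ω, x ∂P := integral_mono (hm x hxp.le) (integrable_const x)
                (fun ω => min_le_right _ _)
          _ = x := by simp
      have h2 : F (2 * x0) ≤ F x := hk_tail_anti X hx'
      calc _ ≤ x * 1 := by linarith
        _ ≤ x * (C * F (2 * x0)) := by gcongr
        _ ≤ x * (C * F x) := by gcongr
        _ = _ := by ring
    intro n
    induction n with
    | zero => intro x hx hx'; exact base x hx (by simpa using hx')
    | succ n ih =>
      intro x hx hx'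
      by_cases hb : x ≤ 2 * x0
      · exact base x hx hb
      push Not at hb
      have hy : x0 ≤ x / 2 := by linarith
      have h1 := ih (x / 2) hy (by rw [pow_succ] at hx'; linarith)
      have h2 := hdouble (x / 2) (by linarith)
      have h3 := hstep (x / 2) hy
      rw [show 2 * (x / 2) = x by ring] at h2 h3
      have hxp : 0 < x := by linarith
      calc _ ≤ (C + 1) * (x / 2) * F (x / 2) := by linarith
        _ ≤ (C + 1) * (x / 2) * (2 * r * F x) := by gcongr
        _ = ((C + 1) * r) * (x * F x) := by ring
        _ ≤ C * (x * F x) := by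
          have := hFpos x
          gcongr
        _ = _ := by ring
  refine ⟨C, x0, hCpos, hx0pos, fun x hx => ?_⟩
  obtain ⟨n, hn⟩ := pow_unbounded_of_one_lt (x / (2 * x0)) (one_lt_two)
  refine key n x hx ?_
  rw [div_lt_iff₀ (by positivity)] at hn
  exact hn.le

lemma hk_exp_intg (Z : Ω → ℝ) (hZ : Measurable Z) (hnn : ∀ ω, 0 ≤ Z ω) (s : ℝ) (hs : 0 ≤ s) :
    Integrable (fun ω => Real.exp (-(s * Z ω))) P := by
  refine hk_intg 1 (by fun_prop) ?_
  intro ω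
  rw [abs_of_pos (Real.exp_pos _)]
  apply Real.exp_le_one_iff.2
  have := mul_nonneg hs (hnn ω)
  linarith

/-- Laplace bound. -/
lemma hk_laplace_bound (X : Ω → ℝ) (hX : Measurable X) (hXnn : ∀ ω, 0 ≤ X ω) {α : ℝ}
    (hα1 : α < 1) (h : RegularlyVarying P X α) :
    ∃ C : ℝ, 0 < C ∧ ∀ᶠ x : ℝ in atTop,
      1 - ∫ ω, Real.exp (-(1 / x * X ω)) ∂P ≤ C * (P {ω | x < X ω}).toReal := by
  obtain ⟨C, x0, hC, hx0, hb⟩ := hk_bound X hX hXnn hα1 h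
  refine ⟨C, hC, ?_⟩
  filter_upwards [eventually_ge_atTop x0] with x hx
  have hxp : 0 < x := by linarith
  have h1 := hb x hx
  have hm : Integrable (fun ω => min (X ω) x) P := by
    refine hk_intg x (hX.min measurable_const) ?_
    intro ω
    rw [abs_of_nonneg (le_min (hXnn ω) hxp.le)]
    exact min_le_right _ _
  have hE := hk_exp_intg (P := P) X hX hXnn (1 / x) (by positivity)
  have h2 : 1 - ∫ ω, Real.exp (-(1 / x * X ω)) ∂P ≤ ∫ ω, 1 / x * min (X ω) x ∂P := by
    have : 1 - ∫ ω, Real.exp (-(1 / x * X ω)) ∂P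
        = ∫ ω, (1 - Real.exp (-(1 / x * X ω))) ∂P := by
      rw [integral_sub (integrable_const 1) hE]; simp
    rw [this]
    refine integral_mono ((integrable_const 1).sub hE) (hm.const_mul _) ?_
    intro ω
    simp only
    rcases le_total (X ω) x with hω | hω
    · rw [min_eq_left hω]
      linarith [Real.add_one_le_exp (-(1 / x * X ω))]
    · rw [min_eq_right hω, one_div, inv_mul_cancel₀ hxp.ne']
      linarith [Real.exp_pos (-(x⁻¹ * X ω))]
  rw [integral_const_mul] at h2
  refine h2.trans ?_
  rw [one_div, inv_mul_le_iff₀ hxp]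
  linarith

end HawkesAux

section HawkesAux2

open Topology

variable {Ω : Type*} [MeasurableSpace Ω] {P : Measure Ω} [IsProbabilityMeasure P]

lemma hk_b_pos (X : Ω → ℝ) (hX : Measurable X) (hXnn : ∀ ω, 0 ≤ X ω) {α : ℝ}
    (h : RegularlyVarying P X α) (s : ℝ) (hs : 0 < s) :
    0 < 1 - ∫ ω, Real.exp (-(s * X ω)) ∂P := by
  have hE := hk_exp_intg (P := P) X hX hXnn s hs.le
  have hi : Integrable (Set.indicator {ω | 1 < X ω} (fun _ => (1:ℝ))) P :=
      (integrable_const 1).indicator (measurableSet_lt measurable_const hX)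
  have e : 1 - ∫ ω, Real.exp (-(s * X ω)) ∂P = ∫ ω, (1 - Real.exp (-(s * X ω))) ∂P := by
      rw [integral_sub (integrable_const 1) hE]; simp
  have hlt : 0 < 1 - Real.exp (-s) := by
    have : Real.exp (-s) < 1 := by
      rw [← Real.exp_zero]; exact Real.exp_lt_exp.2 (by linarith)
    linarith
  have h1 : (1 - Real.exp (-s)) * (P {ω | 1 < X ω}).toReal
      ≤ ∫ ω, (1 - Real.exp (-(s * X ω))) ∂P := by
    rw [hk_tail_eq X hX, ← integral_const_mul]
    refine integral_mono (hi.const_mul _) ((integrable_const 1).sub hE) ?_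
    intro ω
    by_cases hω : 1 < X ω
    · have : ω ∈ {ω | 1 < X ω} := hω
      simp only [Set.indicator_of_mem this, mul_one]
      have : Real.exp (-(s * X ω)) ≤ Real.exp (-s) := by
        apply Real.exp_le_exp.2
        nlinarith
      linarith
    · have : ω ∉ {ω | 1 < X ω} := hω
      simp only [Set.indicator_of_notMem this, mul_zero]
      have : Real.exp (-(s * X ω)) ≤ 1 := by
        apply Real.exp_le_one_iff.2
        have := mul_nonneg hs.le (hXnn ω)
        linarith
      linarith
  rw [e]
  exact lt_of_lt_of_le (mul_pos hlt (hk_tail_pos X h 1)) h1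

lemma hk_ratio (X κA D : Ω → ℝ)
    (hX : Measurable X) (hκAmeas : Measurable κA) (hD : Measurable D)
    (hXnn : ∀ ω, 0 ≤ X ω) (hκAnn : ∀ ω, 0 ≤ κA ω) (hDnn : ∀ ω, 0 ≤ D ω)
    (hκA1 : Integrable κA P) (κ : ℝ) (hκ : κ = ∫ ω, κA ω ∂P) (hκlt : κ < 1)
    (hfix : ∀ s : ℝ, 0 ≤ s →
      ∫ ω, Real.exp (-(s * D ω)) ∂P
        = ∫ ω, Real.exp (-(s * X ω))
            * Real.exp (κA ω * ((∫ ω', Real.exp (-(s * D ω')) ∂P) - 1)) ∂P)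
    (hb : ∀ s : ℝ, 0 < s → 0 < 1 - ∫ ω, Real.exp (-(s * X ω)) ∂P) :
    Tendsto (fun s : ℝ => (1 - ∫ ω, Real.exp (-(s * D ω)) ∂P) /
      (1 - ∫ ω, Real.exp (-(s * X ω)) ∂P)) (𝓝[>] 0) (𝓝 (1 / (1 - κ))) := by
  set a : ℝ → ℝ := fun s => 1 - ∫ ω, Real.exp (-(s * D ω)) ∂P with ha
  have ha0 : ∀ s, 0 < s → 0 ≤ a s := by
    intro s hs
    have : ∫ ω, Real.exp (-(s * D ω)) ∂P ≤ ∫ ω, (1:ℝ) ∂P := by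
      refine integral_mono (hk_exp_intg D hD hDnn s hs.le) (integrable_const 1) ?_
      intro ω
      apply Real.exp_le_one_iff.2
      have := mul_nonneg hs.le (hDnn ω)
      linarith
    simp at this
    simp only [ha]
    linarith
  have hEX : ∀ s, 0 < s → ∀ ω, Real.exp (-(s * X ω)) ≤ 1 := by
    intro s hs ω
    apply Real.exp_le_one_iff.2
    have := mul_nonneg hs.le (hXnn ω)
    linarith
  have hEK : ∀ s, 0 < s → ∀ ω, Real.exp (-(κA ω * a s)) ≤ 1 := by
    intro s hs ω
    apply Real.exp_le_one_iff.2
    have := mul_nonneg (hκAnn ω) (ha0 s hs)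
    linarith
  have hfix' : ∀ s, 0 < s → a s = (1 - ∫ ω, Real.exp (-(s * X ω)) ∂P) +
      ∫ ω, Real.exp (-(s * X ω)) * (1 - Real.exp (-(κA ω * a s))) ∂P := by
    intro s hs
    have h1 := hfix s hs.le
    have h2 : ∀ ω, Real.exp (-(s * X ω)) * (1 - Real.exp (-(κA ω * a s)))
        = Real.exp (-(s * X ω)) - Real.exp (-(s * X ω)) * Real.exp (-(κA ω * a s)) := by
      intro ω; ring
    have h3 : Integrable (fun ω => Real.exp (-(s * X ω)) * Real.exp (-(κA ω * a s))) P := by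
      refine hk_intg 1 (by fun_prop) ?_
      intro ω
      rw [abs_of_pos (by positivity)]
      exact mul_le_one₀ (hEX s hs ω) (Real.exp_pos _).le (hEK s hs ω)
    simp_rw [h2]
    rw [integral_sub (hk_exp_intg X hX hXnn s hs.le) h3]
    have h4 : ∀ ω, κA ω * ((∫ ω', Real.exp (-(s * D ω')) ∂P) - 1) = -(κA ω * a s) := by
      intro ω; simp only [ha]; ring
    simp_rw [h4] at h1
    have h5 : a s = 1 - ∫ ω, Real.exp (-(s * D ω)) ∂P := rfl
    rw [h1] at h5
    linarith
  have hapos : ∀ s, 0 < s → 0 < a s := by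
    intro s hs
    rw [hfix' s hs]
    have : 0 ≤ ∫ ω, Real.exp (-(s * X ω)) * (1 - Real.exp (-(κA ω * a s))) ∂P := by
      refine integral_nonneg fun ω => ?_
      exact mul_nonneg (Real.exp_pos _).le (by linarith [hEK s hs ω])
    linarith [hb s hs]
  have hpos : ∀ᶠ s : ℝ in 𝓝[>] 0, 0 < s := self_mem_nhdsWithin
  have hexp0 : ∀ z : ℝ, Tendsto (fun s : ℝ => Real.exp (-(s * z))) (𝓝[>] 0) (𝓝 1) := by
    intro z
    have : Continuous (fun s : ℝ => Real.exp (-(s * z))) := by fun_prop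
    have := this.tendsto 0
    simp only [zero_mul, neg_zero, Real.exp_zero] at this
    exact this.mono_left nhdsWithin_le_nhds
  have hat : Tendsto a (𝓝[>] 0) (𝓝[>] 0) := by
    refine tendsto_nhdsWithin_iff.2 ⟨?_, hpos.mono fun s hs => hapos s hs⟩
    have : Tendsto (fun s : ℝ => ∫ ω, Real.exp (-(s * D ω)) ∂P) (𝓝[>] 0) (𝓝 (∫ ω, (1:ℝ) ∂P)) := by
      refine tendsto_integral_filter_of_dominated_convergence (fun _ => (1:ℝ)) ?_ ?_
        (integrable_const 1) ?_
      · exact Eventually.of_forall fun s => (by fun_prop : Measurable _).aestronglyMeasurable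
      · filter_upwards [hpos] with s hs
        refine ae_of_all _ fun ω => ?_
        rw [Real.norm_eq_abs, abs_of_pos (Real.exp_pos _)]
        apply Real.exp_le_one_iff.2
        have := mul_nonneg hs.le (hDnn ω)
        linarith
      · exact ae_of_all _ fun ω => hexp0 _
    simpa using this.const_sub 1
  have hslope : ∀ k : ℝ, Tendsto (fun u : ℝ => (1 - Real.exp (-(k * u))) / u) (𝓝[>] 0) (𝓝 k) := by
    intro k
    have h1 : HasDerivAt (fun u : ℝ => 1 - Real.exp (-(k * u))) k 0 := by
      have := (((hasDerivAt_id (0:ℝ)).const_mul k).neg.exp).const_sub 1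
      simpa using this
    have h2 := h1.tendsto_slope_zero_right
    simp only [zero_add, mul_zero, neg_zero, Real.exp_zero, sub_self, sub_zero, smul_eq_mul] at h2
    refine h2.congr fun u => ?_
    rw [div_eq_inv_mul]
  have hmain : Tendsto (fun s : ℝ => ∫ ω, Real.exp (-(s * X ω)) *
      ((1 - Real.exp (-(κA ω * a s))) / a s) ∂P) (𝓝[>] 0) (𝓝 (∫ ω, κA ω ∂P)) := by
    refine tendsto_integral_filter_of_dominated_convergence κA ?_ ?_ hκA1 ?_
    · exact Eventually.of_forall fun s => (by fun_prop : Measurable _).aestronglyMeasurable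
    · filter_upwards [hpos] with s hs
      refine ae_of_all _ fun ω => ?_
      have h0 := hapos s hs
      have h1 : 0 ≤ (1 - Real.exp (-(κA ω * a s))) / a s :=
        div_nonneg (by linarith [hEK s hs ω]) h0.le
      rw [Real.norm_eq_abs, abs_of_nonneg (mul_nonneg (Real.exp_pos _).le h1)]
      calc _ ≤ 1 * ((1 - Real.exp (-(κA ω * a s))) / a s) :=
            mul_le_mul_of_nonneg_right (hEX s hs ω) h1
        _ ≤ κA ω := by
          rw [one_mul, div_le_iff₀ h0]
          linarith [Real.add_one_le_exp (-(κA ω * a s))]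
    · refine ae_of_all _ fun ω => ?_
      have := (hexp0 (X ω)).mul ((hslope (κA ω)).comp hat)
      simpa using this
  rw [← hκ] at hmain
  have hinv : Tendsto (fun s : ℝ => (1 - ∫ ω, Real.exp (-(s * X ω)) ∂P) / a s) (𝓝[>] 0)
      (𝓝 (1 - κ)) := by
    refine (hmain.const_sub 1).congr' ?_
    filter_upwards [hpos] with s hs
    have h0 := (hapos s hs).ne'
    have h1 := hfix' s hs
    simp_rw [← mul_div_assoc]
    rw [integral_div, eq_div_iff h0, sub_mul, div_mul_cancel₀ _ h0]
    linarith
  have := hinv.inv₀ (by linarith : (1 - κ) ≠ 0)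
  rw [one_div]
  refine this.congr fun s => ?_
  rw [inv_div]

lemma hk_Y_mem (Z : Ω → ℝ) (hnn : ∀ ω, 0 ≤ Z ω) {x : ℝ} (hx : 0 < x) (ω : Ω) :
    Real.exp (-(1 / x * Z ω)) ∈ Set.Icc (0:ℝ) 1 := by
  refine ⟨(Real.exp_pos _).le, Real.exp_le_one_iff.2 ?_⟩
  have : 0 ≤ 1 / x * Z ω := mul_nonneg (by positivity) (hnn ω)
  linarith

lemma hk_L_intg (Z : Ω → ℝ) (hZ : Measurable Z) (hnn : ∀ ω, 0 ≤ Z ω) {x : ℝ} (hx : 0 < x)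
    (q : ℝ → ℝ) (hq : Continuous q) :
    Integrable (fun ω => (1 - Real.exp (-(1 / x * Z ω))) * q (Real.exp (-(1 / x * Z ω)))) P := by
  have hc : Continuous (fun y : ℝ => (1 - y) * q y) := by fun_prop
  obtain ⟨C, hC⟩ := isCompact_Icc.exists_bound_of_continuousOn (s := Set.Icc (0:ℝ) 1) hc.continuousOn
  refine hk_intg C ?_ fun ω => hC _ (hk_Y_mem Z hnn hx ω)
  exact hc.measurable.comp (by fun_prop : Measurable fun ω => Real.exp (-(1 / x * Z ω)))

lemma hk_L_one (Z : Ω → ℝ) (hZ : Measurable Z) (hnn : ∀ ω, 0 ≤ Z ω) {x : ℝ} (hx : 0 < x) (n : ℕ) :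
    ∫ ω, (1 - Real.exp (-(1 / x * Z ω))) * (Real.exp (-(1 / x * Z ω))) ^ n ∂P
     = (1 - ∫ ω, Real.exp (-((n + 1 : ℕ) / x * Z ω)) ∂P) -
       (1 - ∫ ω, Real.exp (-(n / x * Z ω)) ∂P) := by
  have h1 := hk_exp_intg (P := P) Z hZ hnn (n / x) (by positivity)
  have h2 := hk_exp_intg (P := P) Z hZ hnn ((n + 1 : ℕ) / x) (by positivity)
  rw [sub_sub_sub_cancel_left, ← integral_sub h1 h2]
  congr 1
  ext ω
  rw [← Real.exp_nat_mul, sub_mul, one_mul, ← Real.exp_add]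
  congr 2
  · ring
  · push_cast; ring

lemma hk_poly (X D : Ω → ℝ) (hX : Measurable X) (hD : Measurable D)
    (hXnn : ∀ ω, 0 ≤ X ω) (hDnn : ∀ ω, 0 ≤ D ω) (F : ℝ → ℝ) (hF : ∀ x, 0 < F x) (K C : ℝ)
    (hb : ∀ s : ℝ, 0 < s → 0 < 1 - ∫ ω, Real.exp (-(s * X ω)) ∂P)
    (hC : ∀ᶠ x : ℝ in atTop, 1 - ∫ ω, Real.exp (-(1 / x * X ω)) ∂P ≤ C * F x)
    (hR : Tendsto (fun s : ℝ => (1 - ∫ ω, Real.exp (-(s * D ω)) ∂P) /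
      (1 - ∫ ω, Real.exp (-(s * X ω)) ∂P)) (𝓝[>] 0) (𝓝 K)) (q : Polynomial ℝ) :
    Tendsto (fun x : ℝ =>
      ((∫ ω, (1 - Real.exp (-(1 / x * D ω))) * q.eval (Real.exp (-(1 / x * D ω))) ∂P)
       - K * ∫ ω, (1 - Real.exp (-(1 / x * X ω))) * q.eval (Real.exp (-(1 / x * X ω))) ∂P) / F x)
      atTop (𝓝 0) := by
  have step : ∀ n : ℕ, Tendsto (fun x : ℝ =>
      ((1 - ∫ ω, Real.exp (-(n / x * D ω)) ∂P)
       - K * (1 - ∫ ω, Real.exp (-(n / x * X ω)) ∂P)) / F x) atTop (𝓝 0) := by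
    intro n
    rcases Nat.eq_zero_or_pos n with rfl | hn
    · simp
    have hn' : (0:ℝ) < n := by exact_mod_cast hn
    have hs : Tendsto (fun x : ℝ => (n:ℝ) / x) atTop (𝓝[>] 0) := by
      refine tendsto_nhdsWithin_iff.2 ⟨tendsto_const_nhds.div_atTop tendsto_id, ?_⟩
      filter_upwards [eventually_gt_atTop 0] with x hx
      exact div_pos hn' hx
    have h1 := (hR.comp hs).sub_const K
    rw [sub_self] at h1
    have h2 := (h1.abs).mul_const (n * C)
    rw [abs_zero, zero_mul] at h2
    refine squeeze_zero_norm' ?_ h2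
    filter_upwards [hC, eventually_gt_atTop 0] with x hx hx0
    have hbp := hb (n / x) (by positivity)
    have hE1 := hk_exp_intg (P := P) X hX hXnn (1 / x) (by positivity)
    have hEn := hk_exp_intg (P := P) X hX hXnn (n / x) (by positivity)
    have hbn : 1 - ∫ ω, Real.exp (-(n / x * X ω)) ∂P
        ≤ n * (1 - ∫ ω, Real.exp (-(1 / x * X ω)) ∂P) := by
      have e1 : 1 - ∫ ω, Real.exp (-(n / x * X ω)) ∂P
          = ∫ ω, (1 - Real.exp (-(n / x * X ω))) ∂P := by
        rw [integral_sub (integrable_const 1) hEn]; simp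
      have e2 : n * (1 - ∫ ω, Real.exp (-(1 / x * X ω)) ∂P)
          = ∫ ω, n * (1 - Real.exp (-(1 / x * X ω))) ∂P := by
        rw [integral_const_mul, integral_sub (integrable_const 1) hE1]; simp
      rw [e1, e2]
      refine integral_mono ((integrable_const 1).sub hEn)
        (((integrable_const 1).sub hE1).const_mul _) fun ω => ?_
      simp only
      have e3 : Real.exp (-(n / x * X ω)) = (Real.exp (-(1 / x * X ω))) ^ n := by
        rw [← Real.exp_nat_mul]; congr 1; ring
      rw [e3]
      have hy := hk_Y_mem X hXnn hx0 ω
      have := one_add_mul_sub_le_pow (a := Real.exp (-(1 / x * X ω))) (by linarith [hy.1]) n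
      linarith
    simp only [Function.comp_apply]
    set A := 1 - ∫ ω, Real.exp (-(n / x * D ω)) ∂P
    set B := 1 - ∫ ω, Real.exp (-(n / x * X ω)) ∂P
    have hFx := hF x
    have e : (A - K * B) / F x = (A / B - K) * (B / F x) := by field_simp
    rw [e, Real.norm_eq_abs, abs_mul]
    refine mul_le_mul_of_nonneg_left ?_ (abs_nonneg _)
    rw [abs_of_pos (by positivity), div_le_iff₀ hFx]
    calc B ≤ n * (C * F x) := hbn.trans (by gcongr)
      _ = _ := by ring
  induction q using Polynomial.induction_on' with
  | add p q hp hq =>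
    have := hp.add hq
    rw [add_zero] at this
    refine this.congr' ?_
    filter_upwards [eventually_gt_atTop 0] with x hx
    simp only [Polynomial.eval_add, mul_add]
    rw [integral_add (hk_L_intg D hD hDnn hx _ p.continuous) (hk_L_intg D hD hDnn hx _ q.continuous),
      integral_add (hk_L_intg X hX hXnn hx _ p.continuous) (hk_L_intg X hX hXnn hx _ q.continuous)]
    ring
  | monomial n c =>
    have := ((step (n + 1)).sub (step n)).const_mul c
    rw [sub_zero, mul_zero] at this
    refine this.congr' ?_
    filter_upwards [eventually_gt_atTop 0] with x hx
    simp only [Polynomial.eval_monomial, mul_left_comm _ c]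
    rw [integral_const_mul, integral_const_mul, hk_L_one D hD hDnn hx, hk_L_one X hX hXnn hx]
    ring

end HawkesAux2

section HawkesAux3

open Topology

variable {Ω : Type*} [MeasurableSpace Ω] {P : Measure Ω} [IsProbabilityMeasure P]

lemma hk_L_close (Z : Ω → ℝ) (hZ : Measurable Z) (hnn : ∀ ω, 0 ≤ Z ω) {x : ℝ} (hx : 0 < x)
    (p q : ℝ → ℝ) (hp : Continuous p) (hq : Continuous q) (δ : ℝ)
    (h : ∀ y ∈ Set.Icc (0:ℝ) 1, |p y - q y| ≤ δ) :
    |(∫ ω, (1 - Real.exp (-(1 / x * Z ω))) * p (Real.exp (-(1 / x * Z ω))) ∂P) -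
      ∫ ω, (1 - Real.exp (-(1 / x * Z ω))) * q (Real.exp (-(1 / x * Z ω))) ∂P|
      ≤ δ * (1 - ∫ ω, Real.exp (-(1 / x * Z ω)) ∂P) := by
  have hE := hk_exp_intg (P := P) Z hZ hnn (1 / x) (by positivity)
  rw [← integral_sub (hk_L_intg Z hZ hnn hx p hp) (hk_L_intg Z hZ hnn hx q hq)]
  have e : δ * (1 - ∫ ω, Real.exp (-(1 / x * Z ω)) ∂P)
      = ∫ ω, δ * (1 - Real.exp (-(1 / x * Z ω))) ∂P := by
    rw [integral_const_mul, integral_sub (integrable_const 1) hE]; simp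
  rw [e, ← Real.norm_eq_abs]
  refine norm_integral_le_of_norm_le (((integrable_const 1).sub hE).const_mul _)
    (ae_of_all _ fun ω => ?_)
  have hy := hk_Y_mem Z hnn hx ω
  rw [← mul_sub, Real.norm_eq_abs, abs_mul, abs_of_nonneg (by linarith [hy.2]), mul_comm]
  exact mul_le_mul_of_nonneg_right (h _ hy) (by linarith [hy.2])

lemma hk_cont (X D : Ω → ℝ) (hX : Measurable X) (hD : Measurable D)
    (hXnn : ∀ ω, 0 ≤ X ω) (hDnn : ∀ ω, 0 ≤ D ω) (F : ℝ → ℝ) (hF : ∀ x, 0 < F x) (K C : ℝ)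
    (hK : 0 < K) (hCpos : 0 < C)
    (hb : ∀ s : ℝ, 0 < s → 0 < 1 - ∫ ω, Real.exp (-(s * X ω)) ∂P)
    (hC : ∀ᶠ x : ℝ in atTop, 1 - ∫ ω, Real.exp (-(1 / x * X ω)) ∂P ≤ C * F x)
    (hR : Tendsto (fun s : ℝ => (1 - ∫ ω, Real.exp (-(s * D ω)) ∂P) /
      (1 - ∫ ω, Real.exp (-(s * X ω)) ∂P)) (𝓝[>] 0) (𝓝 K)) (q : ℝ → ℝ) (hq : Continuous q) :
    Tendsto (fun x : ℝ =>
      ((∫ ω, (1 - Real.exp (-(1 / x * D ω))) * q (Real.exp (-(1 / x * D ω))) ∂P)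
       - K * ∫ ω, (1 - Real.exp (-(1 / x * X ω))) * q (Real.exp (-(1 / x * X ω))) ∂P) / F x)
      atTop (𝓝 0) := by
  have hs : Tendsto (fun x : ℝ => (1:ℝ) / x) atTop (𝓝[>] 0) := by
    refine tendsto_nhdsWithin_iff.2 ⟨tendsto_const_nhds.div_atTop tendsto_id, ?_⟩
    filter_upwards [eventually_gt_atTop 0] with x hx
    exact div_pos one_pos hx
  have hRe := (hR.comp hs).eventually_lt_const (by linarith : K < K + 1)
  rw [Metric.tendsto_nhds]
  intro ε hε
  set M := (2 * K + 1) * C with hM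
  have hMpos : 0 < M := by positivity
  set δ := ε / (2 * M) with hδ
  have hδpos : 0 < δ := by positivity
  obtain ⟨p, hp⟩ := exists_polynomial_near_of_continuousOn 0 1 q hq.continuousOn δ hδpos
  have hpol := hk_poly X D hX hD hXnn hDnn F hF K C hb hC hR p
  have hpe := (Metric.tendsto_nhds.1 hpol) (ε / 2) (by positivity)
  filter_upwards [hC, hRe, hpe, eventually_gt_atTop 0] with x h1 h2 h3 hx
  have hcl : ∀ y ∈ Set.Icc (0:ℝ) 1, |q y - p.eval y| ≤ δ := fun y hy => by
    rw [abs_sub_comm]; exact (hp y hy).le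
  have hcD := hk_L_close (P := P) D hD hDnn hx q (fun y => p.eval y) hq p.continuous δ hcl
  have hcX := hk_L_close (P := P) X hX hXnn hx q (fun y => p.eval y) hq p.continuous δ hcl
  have hbx := hb (1 / x) (by positivity)
  simp only [Function.comp_apply] at h2
  rw [div_lt_iff₀ hbx] at h2
  have hFx := hF x
  rw [dist_zero_right, Real.norm_eq_abs, abs_div, abs_of_pos hFx, div_lt_iff₀ hFx] at h3 ⊢
  set a := 1 - ∫ ω, Real.exp (-(1 / x * D ω)) ∂P
  set b := 1 - ∫ ω, Real.exp (-(1 / x * X ω)) ∂P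
  set A := ∫ ω, (1 - Real.exp (-(1 / x * D ω))) * q (Real.exp (-(1 / x * D ω))) ∂P
  set B := ∫ ω, (1 - Real.exp (-(1 / x * X ω))) * q (Real.exp (-(1 / x * X ω))) ∂P
  set A' := ∫ ω, (1 - Real.exp (-(1 / x * D ω))) * p.eval (Real.exp (-(1 / x * D ω))) ∂P
  set B' := ∫ ω, (1 - Real.exp (-(1 / x * X ω))) * p.eval (Real.exp (-(1 / x * X ω))) ∂P
  have hKB : |K * (B - B')| ≤ K * (δ * b) := by
    rw [abs_mul, abs_of_pos hK]
    exact mul_le_mul_of_nonneg_left hcX hK.le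
  have hδM : δ * M = ε / 2 := by rw [hδ]; field_simp
  have hab : δ * a + K * (δ * b) ≤ ε / 2 * F x := by
    calc δ * a + K * (δ * b) ≤ δ * ((K + 1) * b) + K * (δ * b) := by gcongr
      _ = δ * (2 * K + 1) * b := by ring
      _ ≤ δ * (2 * K + 1) * (C * F x) := by gcongr
      _ = δ * M * F x := by rw [hM]; ring
      _ = _ := by rw [hδM]
  have e : A - K * B = (A' - K * B') + ((A - A') - K * (B - B')) := by ring
  rw [e]
  have t1 := abs_add_le (A' - K * B') ((A - A') - K * (B - B'))
  have t2 := abs_sub (A - A') (K * (B - B'))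
  linarith

/-- cutoff function -/
lemma hk_cutoff (a b : ℝ) (ha : 0 < a) (hab : a < b) : ∃ q : ℝ → ℝ, Continuous q ∧
    (∀ y, (1 - y) * q y ≤ 1 ∧ 0 ≤ (1 - y) * q y) ∧
    (∀ u, b ≤ u → (1 - Real.exp (-u)) * q (Real.exp (-u)) = 1) ∧
    (∀ u, u ≤ a → (1 - Real.exp (-u)) * q (Real.exp (-u)) = 0) := by
  set y0 := Real.exp (-b) with hy0
  set y1 := Real.exp (-a) with hy1
  have h01 : y0 < y1 := Real.exp_lt_exp.2 (by linarith)
  have h11 : y1 < 1 := by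
    rw [← Real.exp_zero]; exact Real.exp_lt_exp.2 (by linarith)
  set p : ℝ → ℝ := fun y => max 0 (min 1 ((y1 - y) / (y1 - y0))) with hp
  have hpc : Continuous p := by simp only [hp]; fun_prop
  have hpz : ∀ y, y1 ≤ y → p y = 0 := by
    intro y hy
    apply max_eq_left
    refine (min_le_right _ _).trans ?_
    exact div_nonpos_of_nonpos_of_nonneg (by linarith) (by linarith)
  have hpo : ∀ y, y ≤ y0 → p y = 1 := by
    intro y hy
    have : 1 ≤ (y1 - y) / (y1 - y0) := by rw [le_div_iff₀ (by linarith)]; linarith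
    simp [hp, min_eq_left this]
  have hpos : ∀ y, 0 < max (1 - y) (1 - y1) := fun y => lt_max_of_lt_right (by linarith)
  have key : ∀ y, (1 - y) * (p y / max (1 - y) (1 - y1)) = p y := by
    intro y
    rcases le_total y1 y with hy | hy
    · simp [hpz y hy]
    · rw [max_eq_left (by linarith), mul_div_cancel₀ _ (by linarith)]
  refine ⟨fun y => p y / max (1 - y) (1 - y1), ?_, ?_, ?_, ?_⟩
  · exact hpc.div (by fun_prop) fun y => (hpos y).ne'
  · intro y
    simp only [key]
    exact ⟨max_le zero_le_one (min_le_left _ _), le_max_left _ _⟩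
  · intro u hu
    simp only [key]
    exact hpo _ (Real.exp_le_exp.2 (by linarith))
  · intro u hu
    simp only [key]
    exact hpz _ (Real.exp_le_exp.2 (by linarith))

lemma hk_sandwich (Z : Ω → ℝ) (hZ : Measurable Z) (hnn : ∀ ω, 0 ≤ Z ω) {x : ℝ} (hx : 0 < x)
    (a b : ℝ) (q : ℝ → ℝ) (hq : Continuous q)
    (h1 : ∀ y, (1 - y) * q y ≤ 1 ∧ 0 ≤ (1 - y) * q y)
    (h2 : ∀ u, b ≤ u → (1 - Real.exp (-u)) * q (Real.exp (-u)) = 1)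
    (h3 : ∀ u, u ≤ a → (1 - Real.exp (-u)) * q (Real.exp (-u)) = 0) :
    (P {ω | b * x < Z ω}).toReal ≤
      ∫ ω, (1 - Real.exp (-(1 / x * Z ω))) * q (Real.exp (-(1 / x * Z ω))) ∂P ∧
    ∫ ω, (1 - Real.exp (-(1 / x * Z ω))) * q (Real.exp (-(1 / x * Z ω))) ∂P ≤
      (P {ω | a * x < Z ω}).toReal := by
  have hi : ∀ c : ℝ, Integrable (Set.indicator {ω | c < Z ω} (fun _ => (1:ℝ))) P := fun c =>
      (integrable_const 1).indicator (measurableSet_lt measurable_const hZ)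
  rw [hk_tail_eq Z hZ, hk_tail_eq Z hZ]
  constructor
  · refine integral_mono (hi _) (hk_L_intg Z hZ hnn hx q hq) fun ω => ?_
    by_cases hω : b * x < Z ω
    · have : ω ∈ {ω | b * x < Z ω} := hω
      simp only [Set.indicator_of_mem this]
      rw [h2]
      rw [one_div, ← div_eq_inv_mul, le_div_iff₀ hx]
      exact hω.le
    · have : ω ∉ {ω | b * x < Z ω} := hω
      simp only [Set.indicator_of_notMem this]
      exact (h1 _).2
  · refine integral_mono (hk_L_intg Z hZ hnn hx q hq) (hi _) fun ω => ?_
    by_cases hω : a * x < Z ω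
    · have : ω ∈ {ω | a * x < Z ω} := hω
      simp only [Set.indicator_of_mem this]
      exact (h1 _).1
    · have : ω ∉ {ω | a * x < Z ω} := hω
      simp only [Set.indicator_of_notMem this]
      rw [h3]
      rw [one_div, ← div_eq_inv_mul, div_le_iff₀ hx]
      exact not_lt.1 hω

end HawkesAux3

/-- **Regular variation transfer for Hawkes clusters, case α ∈ (0,1).**
If the Laplace transform of `D` satisfies the Hawkes fixed-point equation with
`κ = E[κ_A] < 1` and `X` is regularly varying with index `α ∈ (0,1)`, then `D` is regularly
varying with index `α` and `P(D > x) ∼ P(X > x)/(1-κ)`. -/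
theorem hawkes_cluster_regvar_zero_one
    {Ω : Type*} [MeasurableSpace Ω] (P : Measure Ω) [IsProbabilityMeasure P]
    (α : ℝ) (hα0 : 0 < α) (hα1 : α < 1)
    (X κA D : Ω → ℝ)
    (hXmeas : Measurable X) (hκAmeas : Measurable κA) (hDmeas : Measurable D)
    (hXnn : ∀ ω, 0 ≤ X ω) (hκAnn : ∀ ω, 0 ≤ κA ω) (hDnn : ∀ ω, 0 ≤ D ω)
    (hκA1 : Integrable κA P)
    (κ : ℝ) (hκ : κ = ∫ ω, κA ω ∂P) (hκlt : κ < 1)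
    -- the fixed-point equation for the Laplace transform of `D`
    (hfix : ∀ s : ℝ, 0 ≤ s →
      ∫ ω, Real.exp (-(s * D ω)) ∂P
        = ∫ ω, Real.exp (-(s * X ω))
            * Real.exp (κA ω * ((∫ ω', Real.exp (-(s * D ω')) ∂P) - 1)) ∂P)
    -- `X` is regularly varying with index `α ∈ (0,1)`
    (hXrv : RegularlyVarying P X α) :
    RegularlyVarying P D α ∧
    Tendsto (fun x : ℝ => (P {ω | x < D ω}).toReal / (P {ω | x < X ω}).toReal)
      atTop (nhds (1 / (1 - κ))) := by
  have hFpos := hk_tail_pos X hXrv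
  have hb := hk_b_pos X hXmeas hXnn hXrv
  have hR := hk_ratio X κA D hXmeas hκAmeas hDmeas hXnn hκAnn hDnn hκA1 κ hκ hκlt hfix hb
  obtain ⟨C, hCpos, hC⟩ := hk_laplace_bound X hXmeas hXnn hα1 hXrv
  set K := 1 / (1 - κ) with hKdef
  have hK : 0 < K := one_div_pos.2 (by linarith)
  have hcont := hk_cont X D hXmeas hDmeas hXnn hDnn _ hFpos K C hK hCpos hb hC hR
  have hlim : ∀ f : ℝ → ℝ, (∀ c, f c = K * c ^ (-α)) → Tendsto f (nhds 1) (nhds K) := by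
    intro f hf
    have h1 : ContinuousAt (fun c : ℝ => K * c ^ (-α)) 1 :=
      continuousAt_const.mul (Real.continuousAt_rpow_const 1 (-α) (Or.inl one_ne_zero))
    have h2 := h1.tendsto
    simp only [Real.one_rpow, mul_one] at h2
    exact h2.congr fun c => (hf c).symm
  have hlim' := hlim (fun c => K * c ^ (-α)) (fun c => rfl)
  have hmain : Tendsto (fun x : ℝ => (P {ω | x < D ω}).toReal / (P {ω | x < X ω}).toReal)
      atTop (nhds K) := by
    refine tendsto_order.2 ⟨fun m hm => ?_, fun m hm => ?_⟩
    · obtain ⟨b, hbm, hb1⟩ := (((hlim'.mono_left nhdsWithin_le_nhds).eventually_const_lt hm).and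
        (self_mem_nhdsWithin : Set.Ioi (1:ℝ) ∈ nhdsWithin 1 (Set.Ioi 1))).exists
      have hb1' : 1 < b := hb1
      obtain ⟨q, hq, q1, q2, q3⟩ := hk_cutoff 1 b one_pos hb1'
      have hl := (hcont q hq).add ((hk_tail_ratio X hXrv b (by linarith)).const_mul K)
      rw [zero_add] at hl
      filter_upwards [hl.eventually_const_lt hbm, eventually_gt_atTop 0] with x hx hx0
      have sD := (hk_sandwich (P := P) D hDmeas hDnn hx0 1 b q hq q1 q2 q3).2
      have sX := (hk_sandwich (P := P) X hXmeas hXnn hx0 1 b q hq q1 q2 q3).1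
      rw [one_mul] at sD
      refine lt_of_lt_of_le hx ?_
      have hFx := hFpos x
      rw [← mul_div_assoc, ← add_div]
      refine div_le_div_of_nonneg_right ?_ hFx.le
      have := mul_le_mul_of_nonneg_left sX hK.le
      linarith
    · obtain ⟨b, ⟨hbm, hb1⟩, hb0⟩ := ((((hlim'.mono_left nhdsWithin_le_nhds).eventually_lt_const
        hm).and (self_mem_nhdsWithin : Set.Iio (1:ℝ) ∈ nhdsWithin 1 (Set.Iio 1))).and
        (mem_nhdsWithin_of_mem_nhds (Ioi_mem_nhds (zero_lt_one' ℝ)))).exists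
      have hb1' : b < 1 := hb1
      have hb0' : 0 < b := hb0
      obtain ⟨q, hq, q1, q2, q3⟩ := hk_cutoff b 1 hb0' hb1'
      have hl := (hcont q hq).add ((hk_tail_ratio X hXrv b hb0').const_mul K)
      rw [zero_add] at hl
      filter_upwards [hl.eventually_lt_const hbm, eventually_gt_atTop 0] with x hx hx0
      have sD := (hk_sandwich (P := P) D hDmeas hDnn hx0 b 1 q hq q1 q2 q3).1
      have sX := (hk_sandwich (P := P) X hXmeas hXnn hx0 b 1 q hq q1 q2 q3).2
      rw [one_mul] at sD
      refine lt_of_le_of_lt ?_ hx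
      have hFx := hFpos x
      rw [← mul_div_assoc, ← add_div]
      refine div_le_div_of_nonneg_right ?_ hFx.le
      have := mul_le_mul_of_nonneg_left sX hK.le
      linarith
  refine ⟨⟨fun x => x ^ α * (P {ω | x < D ω}).toReal, ?_, ?_⟩, hmain⟩
  · intro c hc
    have hcx : Tendsto (fun x : ℝ => c * x) atTop atTop := tendsto_id.const_mul_atTop hc
    have h1 := (((hmain.comp hcx).mul (hk_tail_ratio X hXrv c hc)).mul
      (hmain.inv₀ hK.ne')).const_mul (c ^ α)
    have e : c ^ α * (K * c ^ (-α) * K⁻¹) = 1 := by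
      rw [Real.rpow_neg hc.le]
      have := (Real.rpow_pos_of_pos hc α).ne'
      field_simp
    rw [e] at h1
    refine h1.congr' ?_
    filter_upwards [eventually_gt_atTop 0] with x hx
    simp only [Function.comp_apply]
    rw [Real.mul_rpow hc.le hx.le]
    have h2 := (hFpos x).ne'
    have h3 := (hFpos (c * x)).ne'
    have h4 := (Real.rpow_pos_of_pos hx α).ne'
    rw [inv_div, div_mul_div_cancel₀ h3, div_mul_div_cancel₀ h2, mul_comm (c ^ α) (x ^ α),
      mul_assoc (x ^ α), mul_div_mul_left _ _ h4, mul_div_assoc]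
  · intro x hx
    rw [← mul_assoc, ← Real.rpow_add hx]
    simp
end

section
/- Let (X,κ_A) be a pair of (possibly dependent) nonnegative random variables with κ=E[κ_A]<1, and let D be a nonnegative random variable whose Laplace transform φ(s)=E[e^{−sD}] satisfies φ(s)=E[e^{−sX}·e^{κ_A(φ(s)−1)}] for all s≥0. Let φ_X(s)=E[e^{−sX}] denote the Laplace transform of X. Then for all s≥0: 0 ≤ φ_X(s) − φ(s) ≤ κ·(1−φ(s)), and consequently 1−φ(s) ≤ (1−φ_X(s))/(1−κ). -/
open MeasureTheory ProbabilityTheory Filter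

/-- **Comparison of the Laplace transforms of the Hawkes cluster sum and of the ancestral
claim.**  If `φ(s) = E[e^{-sD}]` satisfies the Hawkes fixed-point equation
`φ(s) = E[e^{-sX} e^{κ_A (φ(s)-1)}]` with `κ = E[κ_A] < 1`, then for all `s ≥ 0`,
`0 ≤ φ_X(s) - φ(s) ≤ κ (1 - φ(s))` and hence `1 - φ(s) ≤ (1 - φ_X(s))/(1-κ)`. -/
theorem hawkes_laplace_comparison
    {Ω : Type*} [MeasurableSpace Ω] (P : Measure Ω) [IsProbabilityMeasure P]
    (X κA D : Ω → ℝ)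
    (hXmeas : Measurable X) (hκAmeas : Measurable κA) (hDmeas : Measurable D)
    (hXnn : ∀ ω, 0 ≤ X ω) (hκAnn : ∀ ω, 0 ≤ κA ω) (hDnn : ∀ ω, 0 ≤ D ω)
    (hκA1 : Integrable κA P)
    (κ : ℝ) (hκ : κ = ∫ ω, κA ω ∂P) (hκlt : κ < 1)
    -- the Laplace transforms of `D` and `X`
    (φ φX : ℝ → ℝ)
    (hφ : ∀ s : ℝ, φ s = ∫ ω, Real.exp (-(s * D ω)) ∂P)
    (hφX : ∀ s : ℝ, φX s = ∫ ω, Real.exp (-(s * X ω)) ∂P)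
    -- the fixed-point equation
    (hfix : ∀ s : ℝ, 0 ≤ s →
      φ s = ∫ ω, Real.exp (-(s * X ω)) * Real.exp (κA ω * (φ s - 1)) ∂P) :
    ∀ s : ℝ, 0 ≤ s →
      0 ≤ φX s - φ s ∧
      φX s - φ s ≤ κ * (1 - φ s) ∧
      1 - φ s ≤ (1 - φX s) / (1 - κ) := by
  intro s hs
  have hint : ∀ Y : Ω → ℝ, Measurable Y → (∀ ω, 0 ≤ Y ω) →
      Integrable (fun ω => Real.exp (-(Y ω))) P := by
    intro Y hY hn
    refine Integrable.of_bound (C := 1) (by fun_prop) (Eventually.of_forall fun ω => ?_)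
    rw [Real.norm_eq_abs, abs_of_pos (Real.exp_pos _), Real.exp_le_one_iff]
    linarith [hn ω]
  have hD := hint (fun ω => s * D ω) (by fun_prop) (fun ω => mul_nonneg hs (hDnn ω))
  have hX := hint (fun ω => s * X ω) (by fun_prop) (fun ω => mul_nonneg hs (hXnn ω))
  have h1 : φ s ≤ 1 := by
    rw [hφ s]
    have h := integral_mono hD (integrable_const (1 : ℝ)) (fun ω => by
      change Real.exp (-(s * D ω)) ≤ 1
      rw [Real.exp_le_one_iff]
      linarith [mul_nonneg hs (hDnn ω)])
    simpa using h
  have hF := hfix s hs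
  generalize φ s = p at *
  have hXK : Integrable
      (fun ω => Real.exp (-(s * X ω)) * Real.exp (κA ω * (p - 1))) P := by
    have h := hint (fun ω => s * X ω + κA ω * (1 - p)) (by fun_prop) (fun ω =>
      add_nonneg (mul_nonneg hs (hXnn ω)) (mul_nonneg (hκAnn ω) (by linarith)))
    refine h.congr (Eventually.of_forall fun ω => ?_)
    change Real.exp _ = Real.exp _ * Real.exp _
    rw [← Real.exp_add]
    congr 1
    ring
  have hA : p ≤ φX s := by
    rw [hF, hφX s]
    refine integral_mono hXK hX fun ω => ?_
    have : Real.exp (κA ω * (p - 1)) ≤ 1 := by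
      rw [Real.exp_le_one_iff]
      nlinarith [hκAnn ω]
    exact mul_le_of_le_one_right (Real.exp_pos _).le this
  have hB : φX s - p ≤ κ * (1 - p) := by
    have e : φX s - p = ∫ ω, (Real.exp (-(s * X ω)) -
        Real.exp (-(s * X ω)) * Real.exp (κA ω * (p - 1))) ∂P := by
      rw [integral_sub hX hXK, ← hF, hφX s]
    rw [e, hκ, ← integral_mul_const]
    refine integral_mono (hX.sub hXK) (hκA1.mul_const _) fun ω => ?_
    change Real.exp (-(s * X ω)) - Real.exp (-(s * X ω)) * Real.exp (κA ω * (p - 1)) ≤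
      κA ω * (1 - p)
    have a1 : Real.exp (-(s * X ω)) ≤ 1 := by
      rw [Real.exp_le_one_iff]
      linarith [mul_nonneg hs (hXnn ω)]
    have a2 := Real.add_one_le_exp (κA ω * (p - 1))
    have a3 := Real.exp_pos (-(s * X ω))
    have a4 : 0 ≤ κA ω * (1 - p) := mul_nonneg (hκAnn ω) (by linarith)
    nlinarith [mul_le_mul_of_nonneg_left a2 a3.le, mul_le_mul_of_nonneg_right a1 a4]
  refine ⟨by linarith, hB, ?_⟩
  rw [le_div_iff₀ (by linarith)]
  linarith
end
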